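/- Let ℬ be a compact set and {K_B}_{B∈ℬ} be kernels, all satisfying the evenness and two-sided power bounds and the derivative bounds with the same structural constants s, C₁, C₂, C₃. For B ∈ ℬ let g_B be a Lipschitz function in B_R, and assume that if B_j → B as j → ∞ then g_{B_j}(x) → g_B(x) for all x ∈ B_R. Let f be Lipschitz in B_R, set H₀ := sup_{B∈ℬ} ‖(f+g_B)₋‖_{L^∞(B_R)} and H₁ := sup_{B∈ℬ} ‖∇(f+g_B)‖_{L^∞(B_R)}, and let u ∈ C^∞(ℝ^n) ∩ W^{1,∞}(ℝ^n) be a solution of sup_{B∈ℬ}( 𝓛_{K_B} u(x) − g_B(x) ) = f(x) for all x ∈ B_R. Then sup_{B_{R/2}} |∇u| ≤ (C/R)( ‖u‖_{L^∞(ℝ^n)} + R^s H₀^{1/2} ‖u‖_{L^∞(B_R)}^{1/2} + R^{1+2s} H₁ ) for some constant C depending only on the structural constants n, s, C₁, C₂, and C₃. -/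

import Mathlib

open MeasureTheory Filter Metric Set

noncomputable section

/-- Euclidean space `ℝⁿ`. -/
abbrev En (n : ℕ) := EuclideanSpace ℝ (Fin n)

/-- Principal value integral centered at `x`: the limit, as `ε → 0⁺`, of the integrals
over the complement of the `ε`-ball centered at `x`. -/
def pvAt (n : ℕ) (x : En n) (g : En n → ℝ) : ℝ :=
  limUnder (nhdsWithin (0:ℝ) (Set.Ioi 0))
    (fun ε => ∫ y in {y : En n | ε ≤ dist y x}, g y)

/-- Integro-differential operator with kernel `K`:
`𝓛_K u (x) = P.V. ∫ (u x - u y) K (x - y) dy`. -/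
def opK (n : ℕ) (K : En n → ℝ) (u : En n → ℝ) (x : En n) : ℝ :=
  pvAt n x (fun y => (u x - u y) * K (x - y))

/-- The normalizing constant `c_{n,s}` of the fractional Laplacian, for which the
Fourier symbol is `|ξ|^{2s}`. -/
def cns (n : ℕ) (s : ℝ) : ℝ :=
  (4:ℝ) ^ s * s * Real.Gamma ((n:ℝ)/2 + s) / (Real.pi ^ ((n:ℝ)/2) * Real.Gamma (1 - s))

/-- The fractional Laplacian `(-Δ)^s`, for `s ∈ (0,1)`. -/
def fracLap (n : ℕ) (s : ℝ) (u : En n → ℝ) (x : En n) : ℝ :=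
  opK n (fun z => cns n s * ‖z‖ ^ (-((n:ℝ) + 2*s))) u x

/-- Directional derivative `∂_e u`. -/
def dd (n : ℕ) (e : En n) (u : En n → ℝ) (x : En n) : ℝ := fderiv ℝ u x e

/-- Second directional derivative `∂²_e u`. -/
def dd2 (n : ℕ) (e : En n) (u : En n → ℝ) (x : En n) : ℝ := fderiv ℝ (dd n e u) x e

/-- `‖η‖_{C²(ℝⁿ)} ≤ M`. -/
def C2BddBy (n : ℕ) (η : En n → ℝ) (M : ℝ) : Prop :=
  ∀ x : En n, |η x| ≤ M ∧ ‖fderiv ℝ η x‖ ≤ M ∧ ‖fderiv ℝ (fderiv ℝ η) x‖ ≤ M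

/-- The kernel `K` is even and has two-sided power bounds with constants `C₁ ≤ C₂`:
`K(z) = K(-z)` and `C₁ s(1-s)|z|^{-n-2s} ≤ K(z) ≤ C₂ s(1-s)|z|^{-n-2s}` for `z ≠ 0`. -/
def evenPowKernel (n : ℕ) (s C₁ C₂ : ℝ) (K : En n → ℝ) : Prop :=
  (∀ z : En n, z ≠ 0 → K z = K (-z)) ∧
  (∀ z : En n, z ≠ 0 →
    C₁ * (s * (1 - s)) * ‖z‖ ^ (-((n:ℝ) + 2*s)) ≤ K z ∧
    K z ≤ C₂ * (s * (1 - s)) * ‖z‖ ^ (-((n:ℝ) + 2*s)))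

/-- `K ∈ C²(ℝⁿ \ {0})` with `|z||∇K(z)| + |z|²|D²K(z)| ≤ C₃ K(z)` for `z ≠ 0`. -/
def kernelDerivBdd (n : ℕ) (C₃ : ℝ) (K : En n → ℝ) : Prop :=
  ContDiffOn ℝ 2 K {z : En n | z ≠ 0} ∧
  ∀ z : En n, z ≠ 0 →
    ‖z‖ * ‖fderiv ℝ K z‖ + ‖z‖^2 * ‖fderiv ℝ (fderiv ℝ K) z‖ ≤ C₃ * K z

open scoped NNReal

/-- Total mass of the unit sphere of `ℝⁿ`. -/
def sphereMass (n : ℕ) : ℝ := n * (volume : Measure (En n)).real (ball 0 1)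

lemma sphereMass_pos {n : ℕ} (hn : 0 < n) : 0 < sphereMass n := by
  have : 0 < (volume : Measure (En n)).real (ball 0 1) :=
    ENNReal.toReal_pos (measure_ball_pos _ _ one_pos).ne' measure_ball_lt_top.ne
  exact mul_pos (by exact_mod_cast hn) this

lemma pow_mul_rpow_radial {n : ℕ} (hn : 0 < n) (q : ℝ) {t : ℝ} (ht : 0 < t) :
    t ^ (n - 1) * t ^ (-(n : ℝ) + q) = t ^ (q - 1) := by
  rw [← Real.rpow_natCast, ← Real.rpow_add ht, Nat.cast_sub hn]
  congr 1
  push_cast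
  ring

lemma integrableOn_norm_rpow_far {n : ℕ} (hn : 0 < n) {q ρ : ℝ} (hq : 0 < q) (hρ : 0 < ρ) :
    IntegrableOn (fun z : En n => ‖z‖ ^ (-((n : ℝ) + q))) {z | ρ < ‖z‖} ∧
    ∫ z in {z : En n | ρ < ‖z‖}, ‖z‖ ^ (-((n : ℝ) + q)) = sphereMass n * (ρ ^ (-q) / q) := by
  have : Nonempty (Fin n) := ⟨⟨0, hn⟩⟩
  have hms : MeasurableSet {z : En n | ρ < ‖z‖} := measurableSet_lt measurable_const measurable_norm
  have hind : ({z : En n | ρ < ‖z‖}.indicator fun z : En n => ‖z‖ ^ (-((n : ℝ) + q))) =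
      fun z => (Ioi ρ).indicator (fun t : ℝ => t ^ (-((n : ℝ) + q))) ‖z‖ := by
    ext z; simp [indicator]
  have hind' : ∀ t ∈ Ioi (0 : ℝ), t ^ (n - 1) • (Ioi ρ).indicator (fun t : ℝ => t ^ (-((n : ℝ) + q))) t =
      (Ioi ρ).indicator (fun t : ℝ => t ^ (-q - 1)) t := by
    intro t ht
    by_cases h : t ∈ Ioi ρ
    · simp only [indicator_of_mem h, smul_eq_mul]
      rw [neg_add, pow_mul_rpow_radial hn (-q) ht]
    · simp [indicator_of_notMem h]
  have hsub : Ioi (0 : ℝ) ∩ Ioi ρ = Ioi ρ := by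
    rw [Ioi_inter_Ioi]; simp [hρ.le]
  constructor
  · rw [← integrable_indicator_iff hms, hind, integrable_fun_norm_addHaar]
    simp only [finrank_euclideanSpace, Fintype.card_fin]
    rw [integrableOn_congr_fun hind' measurableSet_Ioi, integrableOn_indicator_iff measurableSet_Ioi,
      inter_comm, hsub]
    exact integrableOn_Ioi_rpow_of_lt (by linarith) hρ
  · rw [← integral_indicator hms, hind, integral_fun_norm_addHaar]
    simp only [finrank_euclideanSpace, Fintype.card_fin]
    rw [setIntegral_congr_fun measurableSet_Ioi hind', setIntegral_indicator measurableSet_Ioi, hsub,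
      integral_Ioi_rpow_of_lt (by linarith) hρ]
    simp only [sphereMass, nsmul_eq_mul, smul_eq_mul, sub_add_cancel, mul_assoc]
    rw [neg_div_neg_eq]

lemma integrableOn_norm_rpow_near {n : ℕ} (hn : 0 < n) {q ρ : ℝ} (hq : 0 < q) (hρ : 0 < ρ) :
    IntegrableOn (fun z : En n => ‖z‖ ^ (-(n : ℝ) + q)) {z | ‖z‖ ≤ ρ} ∧
    ∫ z in {z : En n | ‖z‖ ≤ ρ}, ‖z‖ ^ (-(n : ℝ) + q) = sphereMass n * (ρ ^ q / q) := by
  have : Nonempty (Fin n) := ⟨⟨0, hn⟩⟩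
  have hms : MeasurableSet {z : En n | ‖z‖ ≤ ρ} := measurableSet_le measurable_norm measurable_const
  have hind : ({z : En n | ‖z‖ ≤ ρ}.indicator fun z : En n => ‖z‖ ^ (-(n : ℝ) + q)) =
      fun z => (Iic ρ).indicator (fun t : ℝ => t ^ (-(n : ℝ) + q)) ‖z‖ := by
    ext z; simp [indicator]
  have hind' : ∀ t ∈ Ioi (0 : ℝ), t ^ (n - 1) • (Iic ρ).indicator (fun t : ℝ => t ^ (-(n : ℝ) + q)) t =
      (Iic ρ).indicator (fun t : ℝ => t ^ (q - 1)) t := by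
    intro t ht
    by_cases h : t ∈ Iic ρ
    · simp only [indicator_of_mem h, smul_eq_mul]
      rw [pow_mul_rpow_radial hn q ht]
    · simp [indicator_of_notMem h]
  have hsub : Ioi (0 : ℝ) ∩ Iic ρ = Ioc 0 ρ := Ioi_inter_Iic
  constructor
  · rw [← integrable_indicator_iff hms, hind, integrable_fun_norm_addHaar]
    simp only [finrank_euclideanSpace, Fintype.card_fin]
    rw [integrableOn_congr_fun hind' measurableSet_Ioi, integrableOn_indicator_iff measurableSet_Iic,
      inter_comm, hsub, ← intervalIntegrable_iff_integrableOn_Ioc_of_le hρ.le]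
    exact intervalIntegral.intervalIntegrable_rpow' (by linarith)
  · rw [← integral_indicator hms, hind, integral_fun_norm_addHaar]
    simp only [finrank_euclideanSpace, Fintype.card_fin]
    rw [setIntegral_congr_fun measurableSet_Ioi hind', setIntegral_indicator measurableSet_Iic, hsub,
      ← intervalIntegral.integral_of_le hρ.le, integral_rpow (Or.inl (by linarith))]
    simp [sphereMass, nsmul_eq_mul, smul_eq_mul, sub_add_cancel, mul_assoc, Real.zero_rpow hq.ne']

/-- Second-order Taylor bound for symmetric differences of a `C²` function. -/
lemma exists_symmDiff_le {E : Type*} [NormedAddCommGroup E] [NormedSpace ℝ E] [ProperSpace E]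
    {u : E → ℝ} (hu : ContDiff ℝ 2 u) (x : E) :
    ∃ M : ℝ, 0 ≤ M ∧ ∀ z : E, ‖z‖ ≤ 1 → |2 * u x - u (x + z) - u (x - z)| ≤ M * ‖z‖ ^ 2 := by
  have hu1 : ContDiff ℝ 1 (fderiv ℝ u) := hu.fderiv_right (by norm_num)
  have hcont : Continuous fun y => ‖fderiv ℝ (fderiv ℝ u) y‖ :=
    continuous_norm.comp (hu1.continuous_fderiv (by norm_num))
  obtain ⟨M, hM⟩ := (isCompact_closedBall x 1).exists_bound_of_continuousOn hcont.continuousOn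
  replace hM : ∀ y ∈ closedBall x 1, ‖fderiv ℝ (fderiv ℝ u) y‖ ≤ M :=
    fun y hy => (le_abs_self _).trans (hM y hy)
  have hM0 : 0 ≤ M := (norm_nonneg (fderiv ℝ (fderiv ℝ u) x)).trans (hM x (mem_closedBall_self (by norm_num)))
  refine ⟨2 * M, by positivity, fun z hz => ?_⟩
  have hlip : ∀ y : E, ‖y‖ ≤ ‖z‖ → ‖fderiv ℝ u (x + y) - fderiv ℝ u (x - y)‖ ≤ 2 * M * ‖z‖ := by
    intro y hy
    have := (convex_closedBall x 1).norm_image_sub_le_of_norm_fderiv_le (𝕜 := ℝ)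
      (f := fderiv ℝ u) (x := x - y) (y := x + y)
      (fun w _ => (hu1.differentiable (by norm_num)) w) hM
      (by simpa [mem_closedBall, dist_eq_norm] using hy.trans hz)
      (by simpa [mem_closedBall, dist_eq_norm] using hy.trans hz)
    refine this.trans ?_
    have h2 : ‖x + y - (x - y)‖ ≤ 2 * ‖z‖ := by
      rw [show x + y - (x - y) = y + y by abel]
      linarith [norm_add_le y y]
    nlinarith
  have hud : Differentiable ℝ u := hu.differentiable (by norm_num)
  have hder : ∀ y : E, HasFDerivAt (fun y => u (x + y) + u (x - y))
      (fderiv ℝ u (x + y) - fderiv ℝ u (x - y)) y := by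
    intro y
    have h1 : HasFDerivAt (fun y => u (x + y)) (fderiv ℝ u (x + y)) y := by
      exact ((hud (x + y)).hasFDerivAt.comp y ((hasFDerivAt_id y).const_add x)).congr_fderiv (by ext; simp)
    have h2 : HasFDerivAt (fun y => u (x - y)) (-fderiv ℝ u (x - y)) y := by
      exact ((hud (x - y)).hasFDerivAt.comp y ((hasFDerivAt_id y).const_sub x)).congr_fderiv (by ext; simp)
    exact (h1.add h2).congr_fderiv (by ext; simp [sub_eq_add_neg])
  have := (convex_closedBall (0 : E) ‖z‖).norm_image_sub_le_of_norm_hasFDerivWithin_le (𝕜 := ℝ)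
      (f := fun y => u (x + y) + u (x - y)) (x := 0) (y := z) (C := 2 * M * ‖z‖)
      (fun w _ => (hder w).hasFDerivWithinAt) (fun w hw => hlip w (by simpa using hw))
      (by simp) (by simp)
  simp only [add_zero, sub_zero, Real.norm_eq_abs] at this
  rw [abs_sub_comm] at this
  calc |2 * u x - u (x + z) - u (x - z)| = |u x + u x - (u (x + z) + u (x - z))| := by ring_nf
    _ ≤ 2 * M * ‖z‖ * ‖z‖ := this
    _ = _ := by ring

/-- Even smooth cutoffs, equal to one on the half ball and vanishing off the ball of radius `ρ`,
whose gradients are controlled by `D / ρ`. -/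
lemma exists_even_cutoff (n : ℕ) : ∃ D : ℝ, 0 ≤ D ∧ ∀ ρ : ℝ, 0 < ρ → ∃ b : En n → ℝ,
    Differentiable ℝ b ∧ (∀ z, 0 ≤ b z) ∧ (∀ z, b z ≤ 1) ∧ (∀ z, ‖z‖ ≤ ρ / 2 → b z = 1) ∧
    (∀ z, ρ ≤ ‖z‖ → b z = 0) ∧ (∀ z, b (-z) = b z) ∧ ∀ z, ‖fderiv ℝ b z‖ ≤ D / ρ := by
  let B : ContDiffBump (0 : En n) := ⟨1, 2, one_pos, one_lt_two⟩
  have hBd : ContDiff ℝ 1 B := B.contDiff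
  have hcont : Continuous fun y => ‖fderiv ℝ B y‖ :=
    continuous_norm.comp (hBd.continuous_fderiv (by norm_num))
  have hsupp : HasCompactSupport fun y => ‖fderiv ℝ B y‖ := (B.hasCompactSupport.fderiv ℝ).norm
  obtain ⟨D, hD⟩ := hsupp.exists_bound_of_continuous hcont
  replace hD : ∀ y, ‖fderiv ℝ B y‖ ≤ D := fun y => (le_abs_self _).trans (hD y)
  have hD0 : 0 ≤ D := (norm_nonneg (fderiv ℝ B 0)).trans (hD 0)
  refine ⟨2 * D, by positivity, fun ρ hρ => ?_⟩
  have hρ2 : 0 < 2 / ρ := by positivity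
  have hnorm : ∀ z : En n, ‖(2 / ρ) • z‖ = 2 / ρ * ‖z‖ := fun z => by
    rw [norm_smul, Real.norm_of_nonneg hρ2.le]
  have hder : ∀ z, HasFDerivAt (fun z => B ((2 / ρ) • z)) ((2 / ρ) • fderiv ℝ B ((2 / ρ) • z)) z := by
    intro z
    exact ((hBd.differentiable (by norm_num) _).hasFDerivAt.comp z
      ((hasFDerivAt_id z).const_smul (2 / ρ))).congr_fderiv (by ext; simp)
  refine ⟨fun z => B ((2 / ρ) • z), fun z => (hder z).differentiableAt, fun z => B.nonneg,
    fun z => B.le_one, fun z hz => B.one_of_mem_closedBall ?_, fun z hz => B.zero_of_le_dist ?_,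
    fun z => ?_, fun z => ?_⟩
  · rw [mem_closedBall_zero_iff, hnorm]
    calc 2 / ρ * ‖z‖ ≤ 2 / ρ * (ρ / 2) := by gcongr
      _ = 1 := by field_simp
  · rw [dist_zero_right, hnorm]
    calc (2 : ℝ) = 2 / ρ * ρ := by field_simp
      _ ≤ 2 / ρ * ‖z‖ := by gcongr
  · simp only [smul_neg]
    exact B.neg _
  · rw [(hder z).fderiv, norm_smul, Real.norm_of_nonneg hρ2.le]
    calc 2 / ρ * ‖fderiv ℝ B ((2 / ρ) • z)‖ ≤ 2 / ρ * D := by gcongr; exact hD _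
      _ = _ := by ring

lemma measurableSet_le_norm (n : ℕ) (ε : ℝ) : MeasurableSet {z : En n | ε ≤ ‖z‖} :=
  measurableSet_le measurable_const measurable_norm

lemma kernelDerivBdd.aestronglyMeasurable {n : ℕ} (hn : 0 < n) {C₃ : ℝ} {K : En n → ℝ}
    (hK : kernelDerivBdd n C₃ K) : AEStronglyMeasurable K volume := by
  have : Nonempty (Fin n) := ⟨⟨0, hn⟩⟩
  have hms : MeasurableSet ({0}ᶜ : Set (En n)) := (measurableSet_singleton _).compl
  rw [← restrict_compl_singleton (μ := (volume : Measure (En n))) 0]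
  exact hK.1.continuousOn.aestronglyMeasurable hms

lemma evenPowKernel.nonneg {n : ℕ} {s C₁ C₂ : ℝ} (hs : s ∈ Ioo (0 : ℝ) 1) (hC₁ : 0 < C₁)
    {K : En n → ℝ} (hK : evenPowKernel n s C₁ C₂ K) {z : En n} (hz : z ≠ 0) : 0 ≤ K z := by
  refine le_trans ?_ (hK.2 z hz).1
  have := hs.1; have := sub_pos.2 hs.2
  positivity

/-- A bounded function times the kernel is integrable off a ball around the origin. -/
lemma integrableOn_mul_kernel {n : ℕ} (hn : 0 < n) {s C₁ C₂ C₃ : ℝ} (hs : s ∈ Ioo (0 : ℝ) 1)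
    (hC₁ : 0 < C₁) {K : En n → ℝ} (hK : evenPowKernel n s C₁ C₂ K) (hK' : kernelDerivBdd n C₃ K)
    {φ : En n → ℝ} (hφ : AEStronglyMeasurable φ volume) {M : ℝ} (hM : ∀ z, |φ z| ≤ M)
    {ε : ℝ} (hε : 0 < ε) : IntegrableOn (fun z => φ z * K z) {z | ε ≤ ‖z‖} := by
  have h1 : IntegrableOn (fun z : En n => M * (C₂ * (s * (1 - s)) * ‖z‖ ^ (-((n:ℝ) + 2*s))))
      {z | ε ≤ ‖z‖} := by
    have := (integrableOn_norm_rpow_far hn (q := 2 * s) (by linarith [hs.1]) (half_pos hε)).1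
    exact ((this.mono_set fun z (hz : ε ≤ ‖z‖) => (half_lt_self hε).trans_le hz).const_mul _).const_mul _
  refine Integrable.mono' h1 (hφ.mul (hK'.aestronglyMeasurable hn)).restrict ?_
  filter_upwards [ae_restrict_mem (measurableSet_le_norm n ε)] with z hz
  have hz0 : z ≠ 0 := norm_pos_iff.1 (hε.trans_le hz)
  rw [norm_mul, Real.norm_eq_abs, Real.norm_of_nonneg (hK.nonneg hs hC₁ hz0)]
  exact mul_le_mul (hM z) (hK.2 z hz0).2 (hK.nonneg hs hC₁ hz0) ((abs_nonneg _).trans (hM z))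

/-- Symmetrization of an integral against an even kernel off a ball. -/
lemma setIntegral_mul_even {n : ℕ} {J φ : En n → ℝ} (hJ : ∀ z, z ≠ 0 → J z = J (-z))
    {ε : ℝ} (hε : 0 < ε) (hint : IntegrableOn (fun z => φ z * J z) {z | ε ≤ ‖z‖}) :
    IntegrableOn (fun z => 2⁻¹ * (φ z + φ (-z)) * J z) {z | ε ≤ ‖z‖} ∧
    ∫ z in {z : En n | ε ≤ ‖z‖}, φ z * J z =
      ∫ z in {z : En n | ε ≤ ‖z‖}, 2⁻¹ * (φ z + φ (-z)) * J z := by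
  have hms := measurableSet_le_norm n ε
  have hind : ({z : En n | ε ≤ ‖z‖}.indicator fun z => φ (-z) * J z) =
      fun z => ({z : En n | ε ≤ ‖z‖}.indicator fun z => φ z * J z) (-z) := by
    ext z
    by_cases hz : ε ≤ ‖z‖
    · have hz' : ε ≤ ‖-z‖ := by rwa [norm_neg]
      rw [indicator_of_mem (by exact hz), indicator_of_mem (by exact hz'),
        hJ z (norm_pos_iff.1 (hε.trans_le hz))]
    · have hz' : ¬ ε ≤ ‖-z‖ := by rwa [norm_neg]
      rw [indicator_of_notMem (by exact hz), indicator_of_notMem (by exact hz')]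
  have hint' : IntegrableOn (fun z => φ (-z) * J z) {z | ε ≤ ‖z‖} := by
    rw [← integrable_indicator_iff hms, hind]
    exact ((integrable_indicator_iff hms).2 hint).comp_neg
  have heq : ∫ z in {z : En n | ε ≤ ‖z‖}, φ (-z) * J z = ∫ z in {z : En n | ε ≤ ‖z‖}, φ z * J z := by
    rw [← integral_indicator hms, hind, integral_neg_eq_self, integral_indicator hms]
  have hfun : (fun z => 2⁻¹ * (φ z + φ (-z)) * J z) =
      fun z => 2⁻¹ * (φ z * J z) + 2⁻¹ * (φ (-z) * J z) := by ext z; ring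
  rw [hfun]
  refine ⟨(hint.const_mul _).add (hint'.const_mul _), ?_⟩
  rw [integral_add (hint.const_mul _) (hint'.const_mul _), integral_const_mul, integral_const_mul, heq]
  ring

/-- Recentering of the truncated integrals defining the operator. -/
lemma setIntegral_dist_eq {n : ℕ} {K : En n → ℝ} (hK : ∀ z, z ≠ 0 → K z = K (-z)) (u : En n → ℝ)
    (x : En n) {ε : ℝ} (hε : 0 < ε) :
    ∫ y in {y : En n | ε ≤ dist y x}, (u x - u y) * K (x - y) =
      ∫ z in {z : En n | ε ≤ ‖z‖}, (u x - u (x + z)) * K z := by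
  have hms : MeasurableSet {y : En n | ε ≤ dist y x} :=
    measurableSet_le measurable_const (measurable_id.dist measurable_const)
  rw [← integral_indicator hms, ← integral_indicator (measurableSet_le_norm n ε),
    ← integral_add_left_eq_self _ x]
  congr 1
  ext z
  by_cases hz : ε ≤ ‖z‖
  · rw [indicator_of_mem (by simpa using hz), indicator_of_mem (by exact hz),
      hK z (norm_pos_iff.1 (hε.trans_le hz)), sub_add_cancel_left]
  · rw [indicator_of_notMem (by simpa using hz), indicator_of_notMem (by exact hz)]

lemma tendsto_setIntegral_le_norm {n : ℕ} (hn : 0 < n) {G : En n → ℝ} (hG : Integrable G) :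
    Tendsto (fun ε : ℝ => ∫ z in {z : En n | ε ≤ ‖z‖}, G z) (nhdsWithin 0 (Ioi 0))
      (nhds (∫ z, G z)) := by
  have : Nonempty (Fin n) := ⟨⟨0, hn⟩⟩
  simp_rw [← fun ε => integral_indicator (f := G) (μ := volume) (measurableSet_le_norm n ε)]
  refine tendsto_integral_filter_of_dominated_convergence (fun z => ‖G z‖)
    (Eventually.of_forall fun ε => hG.aestronglyMeasurable.indicator (measurableSet_le_norm n ε))
    (Eventually.of_forall fun ε => Eventually.of_forall fun z => norm_indicator_le_norm_self _ _)
    hG.norm ?_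
  filter_upwards [compl_mem_ae_iff.2 (measure_singleton (0 : En n))] with z hz
  have hz0 : 0 < ‖z‖ := norm_pos_iff.2 hz
  refine tendsto_const_nhds.congr' ?_
  filter_upwards [mem_nhdsWithin_of_mem_nhds (Iio_mem_nhds hz0)] with ε hε
  rw [indicator_of_mem]
  exact (mem_Iio.1 hε).le

/-- The principal value defining `opK` exists for bounded `C²` functions. -/
lemma tendsto_opK {n : ℕ} (hn : 0 < n) {s C₁ C₂ C₃ : ℝ} (hs : s ∈ Ioo (0 : ℝ) 1)
    (hC₁ : 0 < C₁) {K : En n → ℝ} (hK : evenPowKernel n s C₁ C₂ K) (hK' : kernelDerivBdd n C₃ K)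
    {u : En n → ℝ} (hu : ContDiff ℝ 2 u) {M : ℝ} (hM : ∀ z, |u z| ≤ M) (x : En n) :
    Tendsto (fun ε : ℝ => ∫ z in {z : En n | ε ≤ ‖z‖}, (u x - u (x + z)) * K z)
      (nhdsWithin 0 (Ioi 0)) (nhds (opK n K u x)) := by
  set G : En n → ℝ := fun z => 2⁻¹ * ((u x - u (x + z)) + (u x - u (x + -z))) * K z with hGdef
  have hφc : Continuous fun z => u x - u (x + z) :=
    continuous_const.sub (hu.continuous.comp (continuous_const.add continuous_id))
  have hφM : ∀ z, |u x - u (x + z)| ≤ M + M := fun z =>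
    (abs_sub _ _).trans (add_le_add (hM _) (hM _))
  have hsym := fun (ε : ℝ) (hε : 0 < ε) => setIntegral_mul_even hK.1 hε
    (integrableOn_mul_kernel hn hs hC₁ hK hK' hφc.aestronglyMeasurable hφM hε)
  have hfar := (hsym 1 one_pos).1
  obtain ⟨M', hM'0, hM'⟩ := exists_symmDiff_le hu x
  have hnear : IntegrableOn G {z | ‖z‖ ≤ 1} := by
    have h1 := ((integrableOn_norm_rpow_near hn (q := 2 - 2 * s) (by linarith [hs.2])
      one_pos).1.const_mul (C₂ * (s * (1 - s)))).const_mul (2⁻¹ * M')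
    refine Integrable.mono' h1 ?_ ?_
    · refine (AEStronglyMeasurable.mul ?_ (hK'.aestronglyMeasurable hn)).restrict
      exact (continuous_const.mul (hφc.add (hφc.comp continuous_neg))).aestronglyMeasurable
    · filter_upwards [ae_restrict_mem (measurableSet_le measurable_norm measurable_const)] with z hz
      by_cases hz0 : z = 0
      · have hs1 := sub_pos.2 hs.2
        have hs0 := hs.1
        have hC₂ : 0 ≤ C₂ := by
          have : Nonempty (Fin n) := ⟨⟨0, hn⟩⟩
          obtain ⟨w, hw⟩ := exists_ne (0 : En n)
          have h := (hK.nonneg hs hC₁ hw).trans (hK.2 w hw).2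
          by_contra hneg
          have : 0 < -C₂ * (s * (1 - s)) * ‖w‖ ^ (-((n:ℝ) + 2*s)) := by
            have := norm_pos_iff.2 hw
            have : 0 < -C₂ := by linarith
            positivity
          linarith
        simp only [hGdef, hz0, neg_zero, add_zero, sub_self, mul_zero, zero_mul, norm_zero]
        positivity
      · have hz1 := norm_pos_iff.2 hz0
        rw [hGdef]
        simp only [norm_mul]
        rw [Real.norm_of_nonneg (hK.nonneg hs hC₁ hz0), Real.norm_of_nonneg (by norm_num : (0:ℝ) ≤ 2⁻¹),
          Real.norm_eq_abs]
        have h2 : |u x - u (x + z) + (u x - u (x + -z))| ≤ M' * ‖z‖ ^ 2 := by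
          convert hM' z hz using 2
          rw [← sub_eq_add_neg]; ring
        have h3 : ‖z‖ ^ (-(n:ℝ) + (2 - 2 * s)) = ‖z‖ ^ 2 * ‖z‖ ^ (-((n:ℝ) + 2*s)) := by
          rw [← Real.rpow_natCast, ← Real.rpow_add hz1]
          congr 1; push_cast; ring
        rw [h3]
        calc _ ≤ 2⁻¹ * (M' * ‖z‖ ^ 2) * (C₂ * (s * (1 - s)) * ‖z‖ ^ (-((n:ℝ) + 2*s))) := by
              refine mul_le_mul (by gcongr) (hK.2 z hz0).2 (hK.nonneg hs hC₁ hz0) (by positivity)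
          _ = _ := by ring
  have hG : Integrable G := by
    rw [← integrableOn_univ]
    refine (hnear.union hfar).mono_set fun z _ => ?_
    exact le_total ‖z‖ 1
  have hlim := tendsto_setIntegral_le_norm hn hG
  have hlim' : Tendsto (fun ε : ℝ => ∫ z in {z : En n | ε ≤ ‖z‖}, (u x - u (x + z)) * K z)
      (nhdsWithin 0 (Ioi 0)) (nhds (∫ z, G z)) := by
    refine hlim.congr' ?_
    filter_upwards [self_mem_nhdsWithin] with ε hε
    exact (hsym ε hε).2.symm
  have hlim'' : Tendsto (fun ε : ℝ => ∫ y in {y : En n | ε ≤ dist y x}, (u x - u y) * K (x - y))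
      (nhdsWithin 0 (Ioi 0)) (nhds (∫ z, G z)) := by
    refine hlim'.congr' ?_
    filter_upwards [self_mem_nhdsWithin] with ε hε
    exact (setIntegral_dist_eq hK.1 u x hε).symm
  rwa [opK, pvAt, hlim''.limUnder_eq]

/-- Cutting the kernel off near the origin, translations of a bounded function are controlled
linearly in the size of the translation. -/
lemma abs_integral_shift_sub_le {n : ℕ} (hn : 0 < n) {s C₁ C₂ C₃ : ℝ} (hs : s ∈ Ioo (0 : ℝ) 1)
    (hC₁ : 0 < C₁) (hC₃ : 0 < C₃) {K : En n → ℝ} (hK : evenPowKernel n s C₁ C₂ K)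
    (hK' : kernelDerivBdd n C₃ K) {b : En n → ℝ} {ρ D : ℝ} (hρ : 0 < ρ) (hbd : Differentiable ℝ b)
    (hb0 : ∀ z, 0 ≤ b z) (hb1 : ∀ z, b z ≤ 1) (hbin : ∀ z, ‖z‖ ≤ ρ / 2 → b z = 1)
    (hbD : ∀ z, ‖fderiv ℝ b z‖ ≤ D / ρ)
    {u : En n → ℝ} (hu : ContDiff ℝ 1 u) {M M' : ℝ} (hM : ∀ z, |u z| ≤ M)
    (hM' : ∀ z, ‖fderiv ℝ u z‖ ≤ M') (x : En n) {e : En n} (he : ‖e‖ = 1) {h : ℝ} (hh : 0 ≤ h) :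
    |∫ z, (u (x + z + h • e) - u (x + z)) * ((1 - b z) * K z)| ≤
      M * ((D / ρ + 2 * C₃ / ρ) * (C₂ * (s * (1 - s))) *
        (sphereMass n * ((ρ / 4) ^ (-(2 * s)) / (2 * s)))) * h := by
  have hρ2 : 0 < ρ / 2 := half_pos hρ
  have hD : 0 ≤ D / ρ := (norm_nonneg _).trans (hbD 0)
  have hud : Differentiable ℝ u := hu.differentiable (by norm_num)
  set κ : En n → ℝ := fun z => (1 - b z) * K z with hκ
  have hint : ∀ (φ : En n → ℝ) (N : ℝ), AEStronglyMeasurable φ volume → (∀ z, |φ z| ≤ N) →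
      Integrable fun z => φ z * κ z := by
    intro φ N hφ hN
    have h1 := integrableOn_mul_kernel hn hs hC₁ hK hK' (φ := fun z => φ z * (1 - b z))
      (hφ.mul (continuous_const.sub hbd.continuous).aestronglyMeasurable) (M := N) (fun z => by
        rw [abs_mul, abs_of_nonneg (sub_nonneg.2 (hb1 z))]
        exact (mul_le_of_le_one_right (abs_nonneg _) (by linarith [hb0 z])).trans (hN z)) hρ2
    simp only [mul_assoc] at h1
    refine (integrableOn_iff_integrable_of_support_subset fun z hz => ?_).1 h1
    by_contra hlt
    refine hz ?_
    simp only [mem_ofPred_eq, not_le] at hlt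
    simp [hκ, hbin z hlt.le]
  have hint0 : Integrable κ := by
    simpa using hint (fun _ => 1) 1 aestronglyMeasurable_const (by simp)
  have hκ0 : ∀ z, ‖z‖ < ρ / 2 → HasFDerivAt κ (0 : En n →L[ℝ] ℝ) z := by
    intro z hz
    refine (hasFDerivAt_const (0 : ℝ) z).congr_of_eventuallyEq ?_
    filter_upwards [(isOpen_lt continuous_norm continuous_const).mem_nhds hz] with y hy
    simp [hκ, hbin y (le_of_lt hy)]
  have hκ1 : ∀ z, z ≠ 0 → HasFDerivAt κ ((1 - b z) • fderiv ℝ K z + K z • (-fderiv ℝ b z)) z := by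
    intro z hz
    have hKd : DifferentiableAt ℝ K z :=
      (hK'.1.contDiffAt (isOpen_ne.mem_nhds hz)).differentiableAt (by norm_num)
    exact ((hbd z).hasFDerivAt.const_sub 1).mul hKd.hasFDerivAt
  have hκd : Differentiable ℝ κ := by
    intro z
    by_cases hz : z = 0
    · exact (hκ0 z (by simpa [hz] using hρ)).differentiableAt
    · exact (hκ1 z hz).differentiableAt
  set c : ℝ := (D / ρ + 2 * C₃ / ρ) * (C₂ * (s * (1 - s))) with hc
  set β : En n → ℝ := {z : En n | ρ / 4 < ‖z‖}.indicator
    (fun z => c * ‖z‖ ^ (-((n:ℝ) + 2*s))) with hβ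
  have hms : MeasurableSet {z : En n | ρ / 4 < ‖z‖} :=
    measurableSet_lt measurable_const measurable_norm
  have hfar := integrableOn_norm_rpow_far hn (q := 2 * s) (by linarith [hs.1]) (by positivity : 0 < ρ / 4)
  have hβi : Integrable β := (integrable_indicator_iff hms).2 (hfar.1.const_mul c)
  have hβint : ∫ z, β z = c * (sphereMass n * ((ρ / 4) ^ (-(2 * s)) / (2 * s))) := by
    rw [hβ, integral_indicator hms, integral_const_mul, hfar.2]
  have hKb : ∀ z, ρ / 2 ≤ ‖z‖ → ‖fderiv ℝ κ z‖ ≤ c * ‖z‖ ^ (-((n:ℝ) + 2*s)) := by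
    intro z hz
    have hz1 : 0 < ‖z‖ := hρ2.trans_le hz
    have hz0 : z ≠ 0 := norm_pos_iff.1 hz1
    have hKz := hK.nonneg hs hC₁ hz0
    have hKder : ‖fderiv ℝ K z‖ ≤ 2 * C₃ / ρ * K z := by
      have h1 := hK'.2 z hz0
      have h2 : ‖z‖ * ‖fderiv ℝ K z‖ ≤ C₃ * K z :=
        le_trans (le_add_of_nonneg_right (by positivity)) h1
      have h3 : ρ / 2 * ‖fderiv ℝ K z‖ ≤ C₃ * K z :=
        (mul_le_mul_of_nonneg_right hz (norm_nonneg _)).trans h2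
      have : 2 * C₃ / ρ * K z = (ρ / 2)⁻¹ * (C₃ * K z) := by field_simp
      rw [this, le_inv_mul_iff₀ hρ2]
      exact h3
    rw [(hκ1 z hz0).fderiv]
    calc _ ≤ ‖(1 - b z) • fderiv ℝ K z‖ + ‖K z • (-fderiv ℝ b z)‖ := norm_add_le _ _
      _ = (1 - b z) * ‖fderiv ℝ K z‖ + K z * ‖fderiv ℝ b z‖ := by
        rw [norm_smul, norm_smul, norm_neg, Real.norm_of_nonneg (sub_nonneg.2 (hb1 z)),
          Real.norm_of_nonneg hKz]
      _ ≤ 1 * (2 * C₃ / ρ * K z) + K z * (D / ρ) := by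
        gcongr
        · linarith [hb0 z]
        · exact hbD z
      _ = (D / ρ + 2 * C₃ / ρ) * K z := by ring
      _ ≤ (D / ρ + 2 * C₃ / ρ) * (C₂ * (s * (1 - s)) * ‖z‖ ^ (-((n:ℝ) + 2*s))) := by
        gcongr
        exact (hK.2 z hz0).2
      _ = _ := by rw [hc]; ring
  have hβb : ∀ z, ‖fderiv ℝ κ z‖ ≤ β z := by
    intro z
    rcases lt_or_ge ‖z‖ (ρ / 2) with hz | hz
    · rw [(hκ0 z hz).fderiv, norm_zero]
      by_cases hz4 : ρ / 4 < ‖z‖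
      · rw [hβ, indicator_of_mem (by exact hz4)]
        obtain ⟨w, hw⟩ : ∃ w : En n, ‖w‖ = ρ := ⟨ρ • e, by
          rw [norm_smul, he, mul_one, Real.norm_of_nonneg hρ.le]⟩
        have h1 := (norm_nonneg _).trans (hKb w (by linarith))
        have h2 : 0 ≤ c := nonneg_of_mul_nonneg_left h1
          (Real.rpow_pos_of_pos (by rw [hw]; exact hρ) _)
        positivity
      · rw [hβ, indicator_of_notMem (by exact hz4)]
    · rw [hβ, indicator_of_mem (by show ρ / 4 < ‖z‖; linarith)]
      exact hKb z hz
  have hκm : AEStronglyMeasurable (fun z => fderiv ℝ κ z e) volume :=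
    (measurable_fderiv_apply_const ℝ κ e).aestronglyMeasurable
  have hκe : ∀ z, |fderiv ℝ κ z e| ≤ β z := fun z => by
    have := (fderiv ℝ κ z).le_opNorm e
    rw [he, mul_one] at this
    exact this.trans (hβb z)
  have hue : ∀ z, |fderiv ℝ u z e| ≤ M' := fun z => by
    have := (fderiv ℝ u z).le_opNorm e
    rw [he, mul_one] at this
    exact this.trans (hM' z)
  have hcs : ∀ t : ℝ, Continuous fun z : En n => x + z + t • e := fun t => by fun_prop
  have hue_c : Continuous fun z => fderiv ℝ u z e :=
    (hu.continuous_fderiv (by norm_num)).clm_apply continuous_const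
  set Φ : ℝ → ℝ := fun t => ∫ z, u (x + z + t • e) * κ z with hΦ
  have hΦd : ∀ t : ℝ, HasDerivAt Φ (∫ z, fderiv ℝ u (x + z + t • e) e * κ z) t := by
    intro t
    refine (hasDerivAt_integral_of_dominated_loc_of_deriv_le (bound := fun z => M' * ‖κ z‖)
      (F' := fun t z => fderiv ℝ u (x + z + t • e) e * κ z)
      Filter.univ_mem (Eventually.of_forall fun τ => ?_) ?_ ?_ ?_ ?_ ?_).2
    · exact (hu.continuous.comp (hcs τ)).aestronglyMeasurable.mul hint0.aestronglyMeasurable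
    · exact hint _ M (hu.continuous.comp (hcs t)).aestronglyMeasurable fun z => hM _
    · exact (hue_c.comp (hcs t)).aestronglyMeasurable.mul hint0.aestronglyMeasurable
    · refine Eventually.of_forall fun z τ _ => ?_
      rw [norm_mul]
      exact mul_le_mul_of_nonneg_right (hue _) (norm_nonneg _)
    · exact hint0.norm.const_mul _
    · refine Eventually.of_forall fun z τ _ => ?_
      have h1 : HasDerivAt (fun τ : ℝ => x + z + τ • e) e τ := by
        simpa using ((hasDerivAt_id τ).smul_const e).const_add (x + z)
      exact ((hud _).hasFDerivAt.comp_hasDerivAt τ h1).mul_const _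
  have hΦb : ∀ t : ℝ, |∫ z, fderiv ℝ u (x + z + t • e) e * κ z| ≤
      M * (c * (sphereMass n * ((ρ / 4) ^ (-(2 * s)) / (2 * s)))) := by
    intro t
    have hUd : ∀ z, HasFDerivAt (fun z => u (x + z + t • e)) (fderiv ℝ u (x + z + t • e)) z := by
      intro z
      exact ((hud (x + z + t • e)).hasFDerivAt.comp z
        (((hasFDerivAt_id z).const_add x).add_const (t • e))).congr_fderiv (by ext; simp)
    have hfe : ∀ z, fderiv ℝ (fun z => u (x + z + t • e)) z = fderiv ℝ u (x + z + t • e) :=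
      fun z => (hUd z).fderiv
    have hi1 : Integrable fun z => fderiv ℝ κ z e * u (x + z + t • e) := by
      refine Integrable.mono' (hβi.mul_const M)
        (hκm.mul (hu.continuous.comp (hcs t)).aestronglyMeasurable)
        (Eventually.of_forall fun z => ?_)
      rw [norm_mul]
      exact mul_le_mul (hκe z) (hM _) (abs_nonneg _) ((abs_nonneg _).trans (hκe z))
    have hibp := integral_mul_fderiv_eq_neg_fderiv_mul_of_integrable (μ := (volume : Measure (En n)))
      (f := κ) (g := fun z => u (x + z + t • e)) (v := e) hi1
      (by
        simp only [hfe, mul_comm (κ _)]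
        exact hint _ M' (hue_c.comp (hcs t)).aestronglyMeasurable fun z => hue _)
      (by
        simp only [mul_comm (κ _)]
        exact hint _ M (hu.continuous.comp (hcs t)).aestronglyMeasurable fun z => hM _)
      (fun z _ => hκd z) (fun z _ => (hUd z).differentiableAt)
    simp only [hfe, mul_comm (κ _)] at hibp
    rw [hibp, abs_neg, mul_comm M, ← hβint, ← integral_mul_const, ← Real.norm_eq_abs]
    refine norm_integral_le_of_norm_le (hβi.mul_const M) (Eventually.of_forall fun z => ?_)
    rw [norm_mul]
    exact mul_le_mul (hκe z) (hM _) (abs_nonneg _) ((abs_nonneg _).trans (hκe z))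
  have hmv := Convex.norm_image_sub_le_of_norm_hasDerivWithin_le
    (𝕜 := ℝ) (f := Φ) (x := 0) (y := h) (s := univ) (fun t _ => (hΦd t).hasDerivWithinAt)
    (fun t _ => (Real.norm_eq_abs _).trans_le (hΦb t)) convex_univ (mem_univ _) (mem_univ _)
  rw [sub_zero, Real.norm_of_nonneg hh] at hmv
  have hsub : ∫ z, (u (x + z + h • e) - u (x + z)) * κ z = Φ h - Φ 0 := by
    simp only [hΦ, zero_smul, add_zero]
    rw [← integral_sub]
    · simp only [sub_mul]
    · exact hint _ M (hu.continuous.comp (hcs h)).aestronglyMeasurable fun z => hM _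
    · exact hint _ M (hu.continuous.comp (continuous_const.add continuous_id)).aestronglyMeasurable
        fun z => hM _
  rw [hsub]
  exact hmv

/-- Lower bound for truncated operators at a point where the function is controlled from above
in the sense of second order symmetric differences. -/
lemma le_setIntegral_of_symmDiff_ge {n : ℕ} (hn : 0 < n) {s C₁ C₂ C₃ : ℝ} (hs : s ∈ Ioo (0 : ℝ) 1)
    (hC₁ : 0 < C₁) (hC₁₂ : C₁ ≤ C₂) {K : En n → ℝ} (hK : evenPowKernel n s C₁ C₂ K)
    (hK' : kernelDerivBdd n C₃ K) {b : En n → ℝ} {ρ : ℝ} (hρ : 0 < ρ) (hbc : Continuous b)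
    (hb0 : ∀ z, 0 ≤ b z) (hb1 : ∀ z, b z ≤ 1) (hbin : ∀ z, ‖z‖ ≤ ρ / 2 → b z = 1)
    (hbout : ∀ z, ρ ≤ ‖z‖ → b z = 0) (hbe : ∀ z, b (-z) = b z)
    {w : En n → ℝ} (hw : Continuous w) {M : ℝ} (hM : ∀ z, |w z| ≤ M) {x : En n} (hx : 0 ≤ w x)
    {Q F : ℝ} (hQ : 0 ≤ Q)
    (hnear : ∀ z, ‖z‖ ≤ ρ → -(w x * Q * ‖z‖ ^ 2) ≤ 2 * w x - w (x + z) - w (x - z))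
    (hfar : ∫ z, w (x + z) * ((1 - b z) * K z) ≤ F) {ε : ℝ} (hε : 0 < ε) (hερ : ε ≤ ρ / 2) :
    w x * (C₁ * (s * (1 - s)) * (sphereMass n * (ρ ^ (-(2 * s)) / (2 * s))) -
      2⁻¹ * Q * (C₂ * (s * (1 - s))) * (sphereMass n * (ρ ^ (2 - 2 * s) / (2 - 2 * s)))) - F ≤
    ∫ z in {z : En n | ε ≤ ‖z‖}, (w x - w (x + z)) * K z := by
  have hs0 := hs.1
  have hs1 := sub_pos.2 hs.2
  have hC₂ : 0 < C₂ := hC₁.trans_le hC₁₂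
  have hmsε := measurableSet_le_norm n ε
  have hwc : Continuous fun z => w (x + z) := hw.comp (continuous_const.add continuous_id)
  have hφc : Continuous fun z => w x - w (x + z) := continuous_const.sub hwc
  have hφM : ∀ z, |w x - w (x + z)| ≤ M + M := fun z =>
    (abs_sub _ _).trans (add_le_add (hM _) (hM _))
  have hintS : ∀ (φ ψ : En n → ℝ) (N r : ℝ), 0 < r → Continuous φ → Continuous ψ →
      (∀ z, 0 ≤ ψ z) → (∀ z, ψ z ≤ 1) → (∀ z, |φ z| ≤ N) →
      IntegrableOn (fun z => φ z * (ψ z * K z)) {z | r ≤ ‖z‖} := by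
    intro φ ψ N r hr hφ hψ hψ0 hψ1 hN
    have h1 := integrableOn_mul_kernel hn hs hC₁ hK hK' (φ := fun z => φ z * ψ z)
      (hφ.mul hψ).aestronglyMeasurable (M := N) (fun z => by
        rw [abs_mul, abs_of_nonneg (hψ0 z)]
        exact (mul_le_of_le_one_right (abs_nonneg _) (hψ1 z)).trans (hN z)) hr
    simpa only [mul_assoc] using h1
  have h1b : Continuous fun z => 1 - b z := continuous_const.sub hbc
  have h1b0 : ∀ z, 0 ≤ 1 - b z := fun z => sub_nonneg.2 (hb1 z)
  have h1b1 : ∀ z, 1 - b z ≤ 1 := fun z => by linarith [hb0 z]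
  have hintκ : ∀ (φ : En n → ℝ) (N : ℝ), Continuous φ → (∀ z, |φ z| ≤ N) →
      Integrable fun z => φ z * ((1 - b z) * K z) := by
    intro φ N hφ hN
    refine (integrableOn_iff_integrable_of_support_subset fun z hz => ?_).1
      (hintS φ _ N (ρ / 2) (half_pos hρ) hφ h1b h1b0 h1b1 hN)
    by_contra hlt
    refine hz ?_
    simp only [mem_ofPred_eq, not_le] at hlt
    simp [hbin z hlt.le]
  have hsplit : ∫ z in {z : En n | ε ≤ ‖z‖}, (w x - w (x + z)) * K z =
      (∫ z in {z : En n | ε ≤ ‖z‖}, (w x - w (x + z)) * (b z * K z)) +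
      ∫ z in {z : En n | ε ≤ ‖z‖}, (w x - w (x + z)) * ((1 - b z) * K z) := by
    rw [← integral_add (hintS _ _ _ ε hε hφc hbc hb0 hb1 hφM)
      (hintS _ _ _ ε hε hφc h1b h1b0 h1b1 hφM)]
    congr 1
    ext z
    ring
  have hfar' : ∫ z in {z : En n | ε ≤ ‖z‖}, (w x - w (x + z)) * ((1 - b z) * K z) =
      w x * (∫ z, (1 - b z) * K z) - ∫ z, w (x + z) * ((1 - b z) * K z) := by
    rw [setIntegral_eq_integral_of_forall_compl_eq_zero]
    · rw [← integral_const_mul, ← integral_sub (hintκ (fun _ => w x) M continuous_const fun _ => hM x)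
        (hintκ _ M hwc fun z => hM _)]
      simp only [sub_mul]
    · intro z hz
      simp only [mem_ofPred_eq, not_le] at hz
      simp [hbin z (hz.le.trans hερ)]
  have hmass : C₁ * (s * (1 - s)) * (sphereMass n * (ρ ^ (-(2 * s)) / (2 * s))) ≤
      ∫ z, (1 - b z) * K z := by
    have hfr := integrableOn_norm_rpow_far hn (q := 2 * s) (by linarith) hρ
    have hms : MeasurableSet {z : En n | ρ < ‖z‖} :=
      measurableSet_lt measurable_const measurable_norm
    have hi : Integrable fun z => (1 - b z) * K z := by
      simpa using hintκ (fun _ => 1) 1 continuous_const (by simp)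
    rw [← hfr.2, ← integral_const_mul]
    refine (setIntegral_mono_on (hfr.1.const_mul _) hi.integrableOn hms fun z hz => ?_).trans
      (setIntegral_le_integral hi (Eventually.of_forall fun z => ?_))
    · have hz' : ρ < ‖z‖ := hz
      rw [hbout z hz'.le, sub_zero, one_mul]
      exact (hK.2 z (norm_pos_iff.1 (hρ.trans hz'))).1
    · by_cases hz0 : z = 0
      · simp [hz0, hbin 0 (by simpa using (half_pos hρ).le)]
      · exact mul_nonneg (h1b0 z) (hK.nonneg hs hC₁ hz0)
  have hnear' : -(w x * (2⁻¹ * Q * (C₂ * (s * (1 - s))) *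
      (sphereMass n * (ρ ^ (2 - 2 * s) / (2 - 2 * s))))) ≤
      ∫ z in {z : En n | ε ≤ ‖z‖}, (w x - w (x + z)) * (b z * K z) := by
    obtain ⟨hsi, hse⟩ := setIntegral_mul_even (J := fun z => b z * K z)
      (fun z hz => by rw [hbe, hK.1 z hz]) hε (hintS _ _ _ ε hε hφc hbc hb0 hb1 hφM)
    rw [hse]
    have hnr := integrableOn_norm_rpow_near hn (q := 2 - 2 * s) (by linarith) hρ
    have hms : MeasurableSet {z : En n | ‖z‖ ≤ ρ} := measurableSet_le measurable_norm measurable_const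
    set k : ℝ := w x * (2⁻¹ * Q * (C₂ * (s * (1 - s)))) with hk
    have hk0 : 0 ≤ k := by positivity
    set γ : En n → ℝ := {z : En n | ‖z‖ ≤ ρ}.indicator
      (fun z => k * ‖z‖ ^ (-(n:ℝ) + (2 - 2 * s))) with hγ
    have hγ0 : ∀ z, 0 ≤ γ z := fun z => indicator_nonneg (fun z _ => by positivity) z
    have hγi : Integrable γ := (integrable_indicator_iff hms).2 (hnr.1.const_mul k)
    have hγe : ∫ z, γ z = k * (sphereMass n * (ρ ^ (2 - 2 * s) / (2 - 2 * s))) := by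
      rw [hγ, integral_indicator hms, integral_const_mul, hnr.2]
    rw [← mul_assoc, ← hk, ← hγe]
    have h1 : -∫ z, γ z ≤ ∫ z in {z : En n | ε ≤ ‖z‖}, -γ z := by
      rw [integral_neg]
      exact neg_le_neg (setIntegral_le_integral hγi (Eventually.of_forall hγ0))
    refine h1.trans (setIntegral_mono_on hγi.neg.integrableOn hsi hmsε fun z hz => ?_)
    have hz1 : 0 < ‖z‖ := hε.trans_le hz
    have hz0 : z ≠ 0 := norm_pos_iff.1 hz1
    have hKz := hK.nonneg hs hC₁ hz0
    by_cases hzρ : ‖z‖ ≤ ρ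
    · rw [hγ, indicator_of_mem (by exact hzρ)]
      have h2 : ‖z‖ ^ (-(n:ℝ) + (2 - 2 * s)) = ‖z‖ ^ 2 * ‖z‖ ^ (-((n:ℝ) + 2*s)) := by
        rw [← Real.rpow_natCast, ← Real.rpow_add hz1]
        congr 1; push_cast; ring
      have h3 := hnear z hzρ
      have h4 : b z * K z ≤ C₂ * (s * (1 - s)) * ‖z‖ ^ (-((n:ℝ) + 2*s)) :=
        (mul_le_of_le_one_left hKz (hb1 z)).trans (hK.2 z hz0).2
      have h5 : 0 ≤ b z * K z := mul_nonneg (hb0 z) hKz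
      rw [h2, hk]
      calc -(w x * (2⁻¹ * Q * (C₂ * (s * (1 - s)))) * (‖z‖ ^ 2 * ‖z‖ ^ (-((n:ℝ) + 2*s))))
          = -(2⁻¹ * (w x * Q * ‖z‖ ^ 2) * (C₂ * (s * (1 - s)) * ‖z‖ ^ (-((n:ℝ) + 2*s)))) := by ring
        _ ≤ -(2⁻¹ * (w x * Q * ‖z‖ ^ 2) * (b z * K z)) := by
          refine neg_le_neg (mul_le_mul_of_nonneg_left h4 (by positivity))
        _ = 2⁻¹ * (-(w x * Q * ‖z‖ ^ 2)) * (b z * K z) := by ring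
        _ ≤ 2⁻¹ * (w x - w (x + z) + (w x - w (x + -z))) * (b z * K z) := by
          refine mul_le_mul_of_nonneg_right ?_ h5
          rw [← sub_eq_add_neg]
          linarith
    · rw [hγ, indicator_of_notMem (by exact hzρ), hbout z (not_le.1 hzρ).le]
      simp
  rw [hsplit, hfar']
  have := mul_le_mul_of_nonneg_left hmass hx
  linarith

lemma symmDiff_inv_sub_norm_sq_le {E : Type*} [NormedAddCommGroup E] [InnerProductSpace ℝ E]
    {x z : E} {R a : ℝ} (hR : 0 < R) (ha : a = R ^ 2 - ‖x‖ ^ 2) (ha0 : 0 < a)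
    (hz : ‖z‖ ≤ a / (8 * R)) :
    0 < R ^ 2 - ‖x + z‖ ^ 2 ∧ 0 < R ^ 2 - ‖x - z‖ ^ 2 ∧
    a / (R ^ 2 - ‖x + z‖ ^ 2) + a / (R ^ 2 - ‖x - z‖ ^ 2) - 2 ≤ 20 * R ^ 2 / a ^ 2 * ‖z‖ ^ 2 := by
  set p : ℝ := 2 * inner ℝ x z with hp
  set q : ℝ := ‖z‖ ^ 2 with hq
  have haR : a ≤ R ^ 2 := by rw [ha]; nlinarith [norm_nonneg x]
  have hxR : ‖x‖ ≤ R := by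
    refine le_of_sq_le_sq ?_ hR.le
    linarith
  have h1 : R ^ 2 - ‖x + z‖ ^ 2 = a - q - p := by
    rw [norm_add_sq_real, ha]; ring
  have h2 : R ^ 2 - ‖x - z‖ ^ 2 = a - q + p := by
    rw [norm_sub_sq_real, ha]; ring
  have hz8 : 8 * R * ‖z‖ ≤ a := by
    rw [le_div_iff₀ (by positivity)] at hz; linarith
  have hpabs : |p| ≤ 2 * R * ‖z‖ := by
    rw [hp, abs_mul, abs_two]
    have := abs_real_inner_le_norm x z
    nlinarith [norm_nonneg z]
  have hp4 : |p| ≤ a / 4 := by linarith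
  have hpp : p ^ 2 ≤ 4 * R ^ 2 * q := by
    rw [← sq_abs]
    calc |p| ^ 2 ≤ (2 * R * ‖z‖) ^ 2 := by gcongr
      _ = _ := by rw [hq]; ring
  have hq0 : 0 ≤ q := by positivity
  have hq4 : q ≤ a / 4 := by
    have : 64 * R ^ 2 * q ≤ a * a := by
      have := mul_le_mul hz8 hz8 (by positivity) ha0.le
      rw [hq]; nlinarith
    have : 64 * R ^ 2 * q ≤ R ^ 2 * a := this.trans (by gcongr)
    have : 64 * q ≤ a := le_of_mul_le_mul_left (by linarith) (by positivity : 0 < R ^ 2)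
    linarith
  obtain ⟨hpl, hpu⟩ := abs_le.1 hp4
  have hd1 : 0 < a - q - p := by linarith
  have hd2 : 0 < a - q + p := by linarith
  rw [h1, h2]
  refine ⟨hd1, hd2, ?_⟩
  have hprod : a ^ 2 / 2 ≤ (a - q - p) * (a - q + p) := by
    have h3 : (3 / 4 * a) ^ 2 ≤ (a - q) ^ 2 := by gcongr; linarith
    have h4 : p ^ 2 ≤ (a / 4) ^ 2 := by rw [← sq_abs]; gcongr
    nlinarith
  have hnum : 2 * q * (a - q) + 2 * p ^ 2 ≤ 10 * R ^ 2 * q := by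
    have : q * (a - q) ≤ q * R ^ 2 := by gcongr; linarith
    nlinarith
  have heq : a / (a - q - p) + a / (a - q + p) - 2 =
      (2 * q * (a - q) + 2 * p ^ 2) / ((a - q - p) * (a - q + p)) := by
    field_simp
    ring
  rw [heq, div_le_iff₀ (by positivity)]
  calc _ ≤ 10 * R ^ 2 * q := hnum
    _ = 20 * R ^ 2 / a ^ 2 * q * (a ^ 2 / 2) := by field_simp; ring
    _ ≤ _ := by gcongr

lemma symmDiff_ge_of_isMaxOn {E : Type*} [NormedAddCommGroup E] [InnerProductSpace ℝ E]
    {w : E → ℝ} {x : E} {R : ℝ} (hR : 0 < R)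
    (hmax : ∀ y ∈ closedBall (0 : E) R, (R ^ 2 - ‖y‖ ^ 2) * w y ≤ (R ^ 2 - ‖x‖ ^ 2) * w x)
    (ha0 : 0 < R ^ 2 - ‖x‖ ^ 2) (hwx : 0 ≤ w x) {z : E}
    (hz : ‖z‖ ≤ (R ^ 2 - ‖x‖ ^ 2) / (8 * R)) :
    -(w x * (20 * R ^ 2 / (R ^ 2 - ‖x‖ ^ 2) ^ 2) * ‖z‖ ^ 2) ≤ 2 * w x - w (x + z) - w (x - z) := by
  set a : ℝ := R ^ 2 - ‖x‖ ^ 2 with ha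
  obtain ⟨h1, h2, h3⟩ := symmDiff_inv_sub_norm_sq_le hR ha ha0 hz
  have hb : ∀ y : E, 0 < R ^ 2 - ‖y‖ ^ 2 → w y ≤ w x * (a / (R ^ 2 - ‖y‖ ^ 2)) := by
    intro y hy
    have hyR : ‖y‖ ≤ R := by
      refine le_of_sq_le_sq ?_ hR.le
      linarith
    rw [← mul_div_assoc, le_div_iff₀ hy, mul_comm, mul_comm (w x)]
    exact hmax y (by simpa using hyR)
  have h4 := hb _ h1
  have h5 := hb _ h2
  have h6 := mul_le_mul_of_nonneg_left h3 hwx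
  linarith

lemma opK_shift_sub_ge {n : ℕ} (hn : 0 < n) {s C₁ C₂ C₃ : ℝ} (hs : s ∈ Ioo (0 : ℝ) 1)
    (hC₁ : 0 < C₁) {K : En n → ℝ} (hK : evenPowKernel n s C₁ C₂ K)
    (hK' : kernelDerivBdd n C₃ K) {u : En n → ℝ} (hu : ContDiff ℝ 2 u) {M : ℝ}
    (hM : ∀ z, |u z| ≤ M) (x v : En n) {r L : ℝ} (hr : 0 < r)
    (hL : ∀ ε, 0 < ε → ε ≤ r → L ≤ ∫ z in {z : En n | ε ≤ ‖z‖},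
      ((u (x + v) - u x) - (u (x + z + v) - u (x + z))) * K z) :
    L ≤ opK n K u (x + v) - opK n K u x := by
  have hlim := (tendsto_opK hn hs hC₁ hK hK' hu hM (x + v)).sub
    (tendsto_opK hn hs hC₁ hK hK' hu hM x)
  refine ge_of_tendsto hlim ?_
  have hint : ∀ (y : En n) (ε : ℝ), 0 < ε →
      IntegrableOn (fun z => (u y - u (y + z)) * K z) {z | ε ≤ ‖z‖} := fun y ε hε =>
    integrableOn_mul_kernel hn hs hC₁ hK hK'
      (continuous_const.sub
        (hu.continuous.comp (continuous_const.add continuous_id))).aestronglyMeasurable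
      (fun z => (abs_sub _ _).trans (add_le_add (hM _) (hM _))) hε
  filter_upwards [self_mem_nhdsWithin, mem_nhdsWithin_of_mem_nhds (Iio_mem_nhds hr)] with ε hε hεr
  rw [← integral_sub (hint _ ε hε) (hint _ ε hε)]
  refine (hL ε hε (mem_Iio.1 hεr).le).trans (le_of_eq ?_)
  congr 1
  ext z
  rw [add_right_comm x v z]
  ring

/-- Bound at a maximum point, obtained by optimizing the splitting radius of the kernel. -/
lemma mul_le_of_splitting_bound {s c₀ c₂ A θ R a ρ W M H h : ℝ} (hs : s ∈ Ioo (0 : ℝ) 1)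
    (hc₀ : 0 < c₀) (hθ : 0 < θ) (hθ1 : θ ≤ 1) (hθ2 : 10 * θ ^ 2 * c₂ ≤ c₀ / 2) (hR : 0 < R)
    (ha : 0 < a) (haR : a ≤ R ^ 2) (hρ : ρ = θ * a / R) (hW : 0 ≤ W)
    (hH : 0 ≤ H) (hh : 0 < h)
    (hle : W * (c₀ * ρ ^ (-(2 * s)) - 2⁻¹ * (20 * R ^ 2 / a ^ 2) * c₂ * ρ ^ (2 - 2 * s)) -
      M * (A / ρ * ρ ^ (-(2 * s))) * h ≤ H * h) :
    a * W ≤ h * (2 * R / (θ * c₀)) * (A * M + R ^ (1 + 2 * s) * H) := by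
  have hρ0 : 0 < ρ := by rw [hρ]; positivity
  have hρR : ρ ≤ R := by
    rw [hρ, div_le_iff₀ hR]
    nlinarith
  have hs0 := hs.1
  have e1 : ρ ^ (2 - 2 * s) = ρ ^ 2 * ρ ^ (-(2 * s)) := by
    rw [← Real.rpow_natCast, ← Real.rpow_add hρ0]
    congr 1
  have hP : 0 < ρ ^ (-(2 * s)) := Real.rpow_pos_of_pos hρ0 _
  have e2 : 2⁻¹ * (20 * R ^ 2 / a ^ 2) * c₂ * ρ ^ (2 - 2 * s) =
      10 * θ ^ 2 * c₂ * ρ ^ (-(2 * s)) := by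
    have : ρ ^ 2 = θ ^ 2 * a ^ 2 / R ^ 2 := by rw [hρ]; ring
    rw [e1, this]
    field_simp
    ring
  rw [e2] at hle
  have h1 : W * (c₀ / 2) * ρ ^ (-(2 * s)) ≤ H * h + M * A / ρ * h * ρ ^ (-(2 * s)) := by
    have : W * (10 * θ ^ 2 * c₂ * ρ ^ (-(2 * s))) ≤ W * (c₀ / 2 * ρ ^ (-(2 * s))) := by gcongr
    have e3 : M * (A / ρ * ρ ^ (-(2 * s))) * h = M * A / ρ * h * ρ ^ (-(2 * s)) := by ring
    rw [e3] at hle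
    linarith
  have hPi : ρ ^ (-(2 * s)) * ρ ^ (1 + 2 * s) = ρ := by
    rw [← Real.rpow_add hρ0]
    simp
  have hQ : 0 < ρ ^ (1 + 2 * s) := Real.rpow_pos_of_pos hρ0 _
  have h2 := mul_le_mul_of_nonneg_right h1 hQ.le
  have h3 : W * (c₀ / 2) * ρ ≤ h * (A * M + ρ ^ (1 + 2 * s) * H) := by
    calc W * (c₀ / 2) * ρ = W * (c₀ / 2) * ρ ^ (-(2 * s)) * ρ ^ (1 + 2 * s) := by
          rw [mul_assoc _ (ρ ^ (-(2 * s))), hPi]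
      _ ≤ _ := h2
      _ = H * h * ρ ^ (1 + 2 * s) + M * A / ρ * h * (ρ ^ (-(2 * s)) * ρ ^ (1 + 2 * s)) := by ring
      _ = _ := by rw [hPi]; field_simp; ring
  have h4 : W * (c₀ / 2) * ρ ≤ h * (A * M + R ^ (1 + 2 * s) * H) := by
    refine h3.trans ?_
    have : ρ ^ (1 + 2 * s) ≤ R ^ (1 + 2 * s) :=
      Real.rpow_le_rpow hρ0.le hρR (by linarith)
    gcongr
  have e4 : a * W = 2 * R / (θ * c₀) * (W * (c₀ / 2) * ρ) := by
    rw [hρ]; field_simp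
  rw [e4]
  calc _ ≤ 2 * R / (θ * c₀) * (h * (A * M + R ^ (1 + 2 * s) * H)) := by gcongr
    _ = _ := by ring

set_option maxHeartbeats 1000000 in
/-- Interior Lipschitz estimate for increments, via the maximum principle. -/
lemma exists_increment_bound {n : ℕ} (hn : 0 < n) {s C₁ C₂ C₃ : ℝ} (hs : s ∈ Ioo (0 : ℝ) 1)
    (hC₁ : 0 < C₁) (hC₁₂ : C₁ ≤ C₂) (hC₃ : 0 < C₃) : ∃ C : ℝ, 0 < C ∧
    ∀ (R h M M' H : ℝ) (u : En n → ℝ) (e : En n), 0 < R → 0 < h → h < R / 4 → ‖e‖ = 1 →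
      ContDiff ℝ 2 u → (∀ z, |u z| ≤ M) → (∀ z, ‖fderiv ℝ u z‖ ≤ M') → 0 ≤ H →
      (∀ δ, 0 < δ → ∀ x ∈ ball (0 : En n) R, x + h • e ∈ ball (0 : En n) R → ∃ K : En n → ℝ,
        evenPowKernel n s C₁ C₂ K ∧ kernelDerivBdd n C₃ K ∧
        opK n K u (x + h • e) - opK n K u x ≤ H * h + δ) →
      ∀ y ∈ ball (0 : En n) (R / 2),
        u (y + h • e) - u y ≤ h * (C / R * (M + R ^ (1 + 2 * s) * H)) := by
  have hs0 := hs.1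
  have hs1 := sub_pos.2 hs.2
  have hC₂ : 0 < C₂ := hC₁.trans_le hC₁₂
  have hσ := sphereMass_pos hn
  obtain ⟨D, hD0, hD⟩ := exists_even_cutoff n
  set c₀ : ℝ := C₁ * (s * (1 - s)) * (sphereMass n / (2 * s)) with hc₀
  set c₂ : ℝ := C₂ * (s * (1 - s)) * (sphereMass n / (2 - 2 * s)) with hc₂
  set A : ℝ := (D + 2 * C₃) * (C₂ * (s * (1 - s))) * (sphereMass n * (4 ^ (2 * s) / (2 * s))) with hA
  have h22 : 0 < 2 - 2 * s := by linarith
  have hc₀0 : 0 < c₀ := by positivity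
  have hc₂0 : 0 < c₂ := by positivity
  have hA0 : 0 ≤ A := by positivity
  set θ : ℝ := min (1 / 8) (c₀ / (20 * c₂)) with hθ
  have hθ0 : 0 < θ := lt_min (by norm_num) (by positivity)
  have hθ8 : θ ≤ 1 / 8 := min_le_left _ _
  have hθ2 : 10 * θ ^ 2 * c₂ ≤ c₀ / 2 := by
    have h1 : θ * (20 * c₂) ≤ c₀ := by
      rw [← le_div_iff₀ (by positivity)]; exact min_le_right _ _
    have h2 : θ * (θ * c₂) ≤ 1 * (θ * c₂) := by gcongr; linarith
    linarith
  refine ⟨7 / (θ * c₀) * (A + 1), by positivity, ?_⟩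
  intro R h M M' H u e hR hh hhR he hu hM hM' hH hop y hy
  have hM0 : 0 ≤ M := (abs_nonneg _).trans (hM 0)
  set r : ℝ := 3 * R / 4 with hr
  have hr0 : 0 < r := by positivity
  set w : En n → ℝ := fun z => u (z + h • e) - u z with hw
  have hwc : Continuous w :=
    (hu.continuous.comp (continuous_id.add continuous_const)).sub hu.continuous
  have hy2 : ‖y‖ < R / 2 := by simpa using hy
  have hηy : 5 / 16 * R ^ 2 ≤ r ^ 2 - ‖y‖ ^ 2 := by
    have : ‖y‖ ^ 2 ≤ (R / 2) ^ 2 := by gcongr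
    have : r ^ 2 = 9 / 16 * R ^ 2 := by rw [hr]; ring
    linarith
  have hηy0 : 0 < r ^ 2 - ‖y‖ ^ 2 := lt_of_lt_of_le (by positivity) hηy
  obtain ⟨x, hxr, hmax⟩ := (isCompact_closedBall (0 : En n) r).exists_isMaxOn
    ⟨0, mem_closedBall_self hr0.le⟩
    (f := fun z => (r ^ 2 - ‖z‖ ^ 2) * w z) (by fun_prop)
  have hmax' : ∀ z ∈ closedBall (0 : En n) r,
      (r ^ 2 - ‖z‖ ^ 2) * w z ≤ (r ^ 2 - ‖x‖ ^ 2) * w x := fun z hz => hmax hz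
  have hyr : y ∈ closedBall (0 : En n) r := by
    rw [mem_closedBall_zero_iff, hr]; linarith
  have hwy := hmax' y hyr
  have hxr' : ‖x‖ ≤ r := by simpa using hxr
  have hax : 0 ≤ r ^ 2 - ‖x‖ ^ 2 := by
    have : ‖x‖ ^ 2 ≤ r ^ 2 := by gcongr
    linarith
  show w y ≤ _
  rcases le_or_gt (w y) 0 with hneg | hpos
  · exact hneg.trans (by positivity)
  have hmx : 0 < (r ^ 2 - ‖x‖ ^ 2) * w x := lt_of_lt_of_le (mul_pos hηy0 hpos) hwy
  have ha0 : 0 < r ^ 2 - ‖x‖ ^ 2 := by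
    rcases hax.eq_or_lt with h0 | h0
    · rw [← h0, zero_mul] at hmx; exact absurd hmx (lt_irrefl _)
    · exact h0
  have hwx : 0 < w x := pos_of_mul_pos_right hmx hax
  set a : ℝ := r ^ 2 - ‖x‖ ^ 2 with ha
  set ρ : ℝ := θ * a / r with hρ
  have hρ0 : 0 < ρ := by positivity
  have hxR : x ∈ ball (0 : En n) R := by
    rw [mem_ball_zero_iff]; rw [hr] at hxr'; linarith
  have hxhR : x + h • e ∈ ball (0 : En n) R := by
    rw [mem_ball_zero_iff]
    have := norm_add_le x (h • e)
    rw [norm_smul, he, mul_one, Real.norm_of_nonneg hh.le] at this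
    rw [hr] at hxr'; linarith
  obtain ⟨b, hbd, hb0, hb1, hbin, hbout, hbe, hbD⟩ := hD ρ hρ0
  have key : w x * (c₀ * ρ ^ (-(2 * s)) - 2⁻¹ * (20 * r ^ 2 / a ^ 2) * c₂ * ρ ^ (2 - 2 * s)) -
      M * (A / ρ * ρ ^ (-(2 * s))) * h ≤ H * h := by
    refine le_of_forall_pos_le_add fun δ hδ => ?_
    obtain ⟨K, hK, hK', hKu⟩ := hop δ hδ x hxR hxhR
    refine le_trans ?_ hKu
    refine opK_shift_sub_ge hn hs hC₁ hK hK' hu hM x (h • e) (half_pos hρ0) fun ε hε hερ => ?_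
    have hfar := (le_abs_self _).trans (abs_integral_shift_sub_le hn hs hC₁ hC₃ hK hK' hρ0 hbd hb0
      hb1 hbin hbD (hu.of_le (by norm_num)) hM hM' x he hh.le)
    refine le_trans (le_of_eq ?_) (le_setIntegral_of_symmDiff_ge hn hs hC₁ hC₁₂ hK hK' hρ0
      hbd.continuous hb0 hb1 hbin hbout hbe hwc (M := M + M)
      (fun z => (abs_sub _ _).trans (add_le_add (hM _) (hM _))) hwx.le
      (Q := 20 * r ^ 2 / a ^ 2) (by positivity) (fun z hz => ?_) hfar hε hερ)
    · have h4 : (ρ / 4) ^ (-(2 * s)) = 4 ^ (2 * s) * ρ ^ (-(2 * s)) := by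
        rw [Real.div_rpow hρ0.le (by norm_num), Real.rpow_neg (by norm_num : (0:ℝ) ≤ 4), div_inv_eq_mul,
          mul_comm]
      rw [h4, hc₀, hc₂, hA]
      ring
    · refine symmDiff_ge_of_isMaxOn hr0 hmax' ha0 hwx.le (hz.trans ?_)
      rw [hρ, mul_comm (8 : ℝ), ← div_div, div_right_comm, ← ha, mul_comm θ, mul_div_assoc,
        div_eq_mul_inv a 8, div_eq_mul_inv (a * 8⁻¹), div_eq_mul_inv θ, ← mul_assoc]
      gcongr
      linarith
  have har : a ≤ r ^ 2 := by rw [ha]; linarith [sq_nonneg ‖x‖]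
  have hfin := mul_le_of_splitting_bound hs hc₀0 hθ0 (by linarith) hθ2 hr0 ha0 har hρ hwx.le hH
    hh key
  have hrR : r ≤ R := by rw [hr]; linarith
  have h5 : 5 / 16 * R ^ 2 * w y ≤
      h * (2 * R / (θ * c₀)) * ((A + 1) * (M + R ^ (1 + 2 * s) * H)) := by
    calc 5 / 16 * R ^ 2 * w y ≤ (r ^ 2 - ‖y‖ ^ 2) * w y := by gcongr
      _ ≤ a * w x := hwy
      _ ≤ _ := hfin
      _ ≤ h * (2 * R / (θ * c₀)) * (A * M + R ^ (1 + 2 * s) * H) := by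
        gcongr
      _ ≤ _ := by
        refine mul_le_mul_of_nonneg_left ?_ (by positivity)
        have h0 : 0 ≤ R ^ (1 + 2 * s) * H := by positivity
        have h1 := mul_nonneg hA0 h0
        linarith
  set T : ℝ := (A + 1) * (M + R ^ (1 + 2 * s) * H) with hT
  have hT0 : 0 ≤ T := by positivity
  have h6 : w y ≤ h * (32 / 5 / (θ * c₀) / R * T) := by
    have : h * (32 / 5 / (θ * c₀) / R * T) = (h * (2 * R / (θ * c₀)) * T) / (5 / 16 * R ^ 2) := by
      field_simp
      ring
    rw [this, le_div_iff₀ (by positivity)]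
    linarith
  calc w y ≤ h * (32 / 5 / (θ * c₀) / R * T) := h6
    _ ≤ h * (7 / (θ * c₀) / R * T) := by gcongr; norm_num
    _ = _ := by rw [hT]; ring

/-- A one-sided bound on all small increments in unit directions bounds the gradient. -/
lemma norm_fderiv_le_of_increment_le {E : Type*} [NormedAddCommGroup E] [NormedSpace ℝ E]
    {u : E → ℝ} {y : E} (hu : DifferentiableAt ℝ u y) {B r : ℝ} (hB : 0 ≤ B) (hr : 0 < r)
    (h : ∀ e : E, ‖e‖ = 1 → ∀ t, 0 < t → t < r → u (y + t • e) - u y ≤ t * B) :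
    ‖fderiv ℝ u y‖ ≤ B := by
  have hone : ∀ e : E, ‖e‖ = 1 → fderiv ℝ u y e ≤ B := by
    intro e he
    have hd : HasDerivAt (fun t : ℝ => u (y + t • e)) (fderiv ℝ u y e) 0 :=
      hu.hasFDerivAt.hasLineDerivAt e
    have hlim := hd.tendsto_slope_zero_right
    refine le_of_tendsto hlim ?_
    filter_upwards [self_mem_nhdsWithin, mem_nhdsWithin_of_mem_nhds (Iio_mem_nhds hr)] with t ht htr
    have ht0 : 0 < t := ht
    simp only [zero_add, zero_smul, add_zero, smul_eq_mul]
    rw [inv_mul_le_iff₀ ht0]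
    exact h e he t ht0 htr
  refine ContinuousLinearMap.opNorm_le_of_unit_norm hB fun e he => ?_
  rw [Real.norm_eq_abs, abs_le]
  have := hone (-e) (by rwa [norm_neg])
  rw [map_neg] at this
  exact ⟨by linarith, hone e he⟩

/-- gradient estimate for Pucci-type maximal equations built from a compact
family of general kernels.  If `u ∈ C^∞ ∩ W^{1,∞}` solves
`sup_{B ∈ ℬ} (𝓛_{K_B} u − g_B) = f` in `B_R`, then
`sup_{B_{R/2}} |∇u| ≤ (C/R)(‖u‖_{L^∞(ℝⁿ)} + R^s H₀^{1/2}‖u‖^{1/2}_{L^∞(B_R)} + R^{1+2s} H₁)`,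
with `C` depending only on `n, s, C₁, C₂, C₃`. -/
theorem pucci_general_kernels_gradient_estimate (n : ℕ) (hn : 0 < n)
    (s C₁ C₂ C₃ : ℝ) (hs : s ∈ Set.Ioo (0:ℝ) 1)
    (hC₁ : 0 < C₁) (hC₁₂ : C₁ ≤ C₂) (hC₃ : 0 < C₃) :
    ∃ C : ℝ, 0 < C ∧
    ∀ (ι : Type) [TopologicalSpace ι] [CompactSpace ι] [Nonempty ι],
    ∀ (K : ι → En n → ℝ),
      (∀ b : ι, evenPowKernel n s C₁ C₂ (K b) ∧ kernelDerivBdd n C₃ (K b)) →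
    ∀ (R : ℝ), 0 < R →
    ∀ (f : En n → ℝ) (g : ι → En n → ℝ) (u : En n → ℝ),
      (∃ Lf : ℝ≥0, LipschitzOnWith Lf f (ball (0 : En n) R)) →
      (∀ b : ι, ∃ L : ℝ≥0, LipschitzOnWith L (g b) (ball (0 : En n) R)) →
      -- continuity of `g_B` in `B`
      (∀ (Bj : ℕ → ι) (b : ι), Tendsto Bj atTop (nhds b) →
        ∀ x ∈ ball (0 : En n) R, Tendsto (fun j => g (Bj j) x) atTop (nhds (g b x))) →
      ContDiff ℝ (⊤ : ℕ∞) u →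
      (∃ Mu : ℝ, ∀ x, |u x| ≤ Mu ∧ ‖fderiv ℝ u x‖ ≤ Mu) →
      -- the equation `sup_B (𝓛_{K_B} u − g_B) = f` in `B_R`
      (∀ x ∈ ball (0 : En n) R,
        IsLUB (Set.range fun b : ι => opK n (K b) u x - g b x) (f x)) →
    ∀ (Minf MR H₀ H₁ : ℝ),
      (∀ x : En n, |u x| ≤ Minf) →
      (∀ x ∈ ball (0 : En n) R, |u x| ≤ MR) →
      0 ≤ H₀ → (∀ b : ι, ∀ x ∈ ball (0 : En n) R, -H₀ ≤ f x + g b x) →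
      0 ≤ H₁ → (∀ b : ι, ∀ x ∈ ball (0 : En n) R, ∀ y ∈ ball (0 : En n) R,
          |(f x + g b x) - (f y + g b y)| ≤ H₁ * dist x y) →
      ∀ x ∈ ball (0 : En n) (R/2),
        ‖fderiv ℝ u x‖ ≤
          C / R * (Minf + R ^ s * Real.sqrt H₀ * Real.sqrt MR + R ^ (1 + 2*s) * H₁) := by
  obtain ⟨C, hC, hmain⟩ := exists_increment_bound hn hs hC₁ hC₁₂ hC₃
  refine ⟨C, hC, ?_⟩
  intro ι _ _ _ K hK R hR f g u _ _ _ hu hMu heq Minf MR H₀ H₁ hMinf _ _ _ hH₁ hfg y hy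
  obtain ⟨Mu, hMu⟩ := hMu
  have hMinf0 : 0 ≤ Minf := (abs_nonneg _).trans (hMinf 0)
  have hu2 : ContDiff ℝ 2 u := (contDiff_infty.1 hu) 2
  have hB : ‖fderiv ℝ u y‖ ≤ C / R * (Minf + R ^ (1 + 2 * s) * H₁) := by
    refine norm_fderiv_le_of_increment_le (hu2.differentiable (by norm_num) y) (by positivity)
      (by positivity : 0 < R / 4) fun e he t ht htR => ?_
    refine hmain R t Minf Mu H₁ u e hR ht htR he hu2 hMinf (fun z => (hMu z).2) hH₁
      (fun δ hδ x hx hxt => ?_) y hy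
    obtain ⟨_, ⟨b, rfl⟩, hb⟩ := (lt_isLUB_iff (heq x hx)).1 (sub_lt_self (f x) hδ)
    refine ⟨K b, (hK b).1, (hK b).2, ?_⟩
    have h1 : opK n (K b) u (x + t • e) - g b (x + t • e) ≤ f (x + t • e) :=
      (heq _ hxt).1 ⟨b, rfl⟩
    have h2 := (le_abs_self _).trans (hfg b _ hxt x hx)
    have h3 : dist (x + t • e) x = t := by
      rw [dist_eq_norm, add_sub_cancel_left, norm_smul, he, mul_one, Real.norm_of_nonneg ht.le]
    rw [h3] at h2
    simp only at hb
    linarith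
  refine hB.trans ?_
  have : 0 ≤ R ^ s * Real.sqrt H₀ * Real.sqrt MR := by positivity
  gcongr
  linarith
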